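/- arXiv:1209.4094 — 6 statements merged into one kernel-verified Lean document; each statement's English description precedes it below -/
import Mathlib

section
/- Let α be a partial action of a group G on a k-algebra A and let (μ, β) be an enveloping pair of α, where β acts on the k-algebra B. Then the kernel of the map π : B → M(F(G,A)) equals the annihilator Ann(B) of B. -/
set_option linter.unusedSectionVars false
set_option linter.unusedVariables false

universe u v w x y

section PartialActionPrelim

variable (k : Type u) [CommRing k] (G : Type v) [Group G] (A : Type w)
  [NonUnitalRing A] [Module k A] [SMulCommClass k A A] [IsScalarTower k A A]

/-- A partial action of a group `G` on a (not necessarily unital) `k`-algebra `A`: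
a family of two-sided ideals `A_t` and algebra isomorphisms `α_t : A_{t⁻¹} → A_t`
(encoded by total functions `act t : A → A` whose behaviour only matters on `A_{t⁻¹}`). -/
structure AlgPartialAction : Type (max u v w) where
  ideal : G → Submodule k A
  act : G → A → A
  mul_mem_left : ∀ (t : G) (a : A), ∀ x ∈ ideal t, a * x ∈ ideal t
  mul_mem_right : ∀ (t : G) (a : A), ∀ x ∈ ideal t, x * a ∈ ideal t
  ideal_one : ideal 1 = ⊤
  act_one : ∀ a : A, act 1 a = a
  act_mem : ∀ t : G, ∀ a ∈ ideal t⁻¹, act t a ∈ ideal t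
  act_add : ∀ t : G, ∀ a ∈ ideal t⁻¹, ∀ b ∈ ideal t⁻¹, act t (a + b) = act t a + act t b
  act_smul : ∀ (t : G) (c : k), ∀ a ∈ ideal t⁻¹, act t (c • a) = c • act t a
  act_mul : ∀ t : G, ∀ a ∈ ideal t⁻¹, ∀ b ∈ ideal t⁻¹, act t (a * b) = act t a * act t b
  act_injOn : ∀ t : G, Set.InjOn (act t) (ideal t⁻¹ : Set A)
  act_image : ∀ s t : G,
    act t '' ((ideal t⁻¹ : Set A) ∩ (ideal s : Set A)) = (ideal t : Set A) ∩ (ideal (t * s) : Set A)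
  act_comp : ∀ s t : G, ∀ a ∈ ideal t⁻¹, act t a ∈ ideal s⁻¹ → act s (act t a) = act (s * t) a

/-- The annihilator `Ann(B) = {b ∈ B : bB = Bb = 0}`. -/
def annih (B : Type x) [NonUnitalRing B] : Set B := {b | ∀ c : B, b * c = 0 ∧ c * b = 0}

variable {k G A}

/-- An enveloping pair `(μ, β)` for a partial action `α`: a global action `β` of `G` on `B`,
an injective algebra homomorphism `μ : A → B` whose range is an ideal, with
`μ(A_t) = μ(A) ∩ β_t(μ(A))`, `β_t ∘ μ = μ ∘ α_t` on `A_{t⁻¹}`, and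
`span {β_t(μ(A)) : t ∈ G} = B`. -/
structure EnvPair (α : AlgPartialAction k G A) (B : Type x) [NonUnitalRing B]
    [Module k B] [SMulCommClass k B B] [IsScalarTower k B B] : Type (max u v w x) where
  β : G → B →ₙₐ[k] B
  β_one : ∀ b : B, β 1 b = b
  β_comp : ∀ (s t : G) (b : B), β (s * t) b = β s (β t b)
  μ : A →ₙₐ[k] B
  μ_inj : Function.Injective μ
  μ_mul_mem_left : ∀ b : B, ∀ x ∈ Set.range μ, b * x ∈ Set.range μ
  μ_mul_mem_right : ∀ b : B, ∀ x ∈ Set.range μ, x * b ∈ Set.range μ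
  inter : ∀ t : G, ⇑μ '' (α.ideal t : Set A) = Set.range μ ∩ (⇑(β t) '' Set.range μ)
  equivar : ∀ t : G, ∀ a ∈ α.ideal t⁻¹, β t (μ a) = μ (α.act t a)
  spans : Submodule.span k (⋃ t : G, ⇑(β t) '' Set.range μ) = ⊤

/-- An isomorphism of enveloping pairs: an algebra isomorphism `φ` intertwining the global
actions with `φ ∘ μ = ν`. -/
def IsEnvPairIso {α : AlgPartialAction k G A} {B : Type x} [NonUnitalRing B]
    [Module k B] [SMulCommClass k B B] [IsScalarTower k B B]
    {C : Type y} [NonUnitalRing C] [Module k C] [SMulCommClass k C C] [IsScalarTower k C C]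
    (P : EnvPair α B) (Q : EnvPair α C) (φ : B → C) : Prop :=
  Function.Bijective φ ∧ (∀ x y : B, φ (x + y) = φ x + φ y) ∧
    (∀ x y : B, φ (x * y) = φ x * φ y) ∧ (∀ (c : k) (x : B), φ (c • x) = c • φ x) ∧
    (∀ (t : G) (b : B), φ (P.β t b) = Q.β t (φ b)) ∧ ∀ a : A, φ (P.μ a) = Q.μ a

/-- An enveloping family of functions for a partial action `α` (Definition 1.7). -/
structure IsEnvFamily (α : AlgPartialAction k G A) (F : G → A → A → A) : Prop where
  mem : ∀ (t : G) (a b : A), F t a b ∈ α.ideal t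
  add_left : ∀ (t : G) (a a' b : A), F t (a + a') b = F t a b + F t a' b
  add_right : ∀ (t : G) (a b b' : A), F t a (b + b') = F t a b + F t a b'
  smul_left : ∀ (t : G) (c : k) (a b : A), F t (c • a) b = c • F t a b
  smul_right : ∀ (t : G) (c : k) (a b : A), F t a (c • b) = c • F t a b
  F_one : ∀ a b : A, F 1 a b = a * b
  cond2a : ∀ (t : G) (a b c : A), F t a (b * c) = F t a b * c
  cond2b : ∀ (t : G) (a b c : A), α.act t (F t⁻¹ (a * b) c) = a * α.act t (F t⁻¹ b c)
  cond2c : ∀ (t : G) (a b c : A), a * F t b c = α.act t (F t⁻¹ a b) * c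
  cond3a : ∀ (s t : G) (a b c : A), F t (F s a b) c = F (t * s) a (F t b c)
  cond3b : ∀ (s t : G) (a b c : A), F t (α.act s⁻¹ (F s a b)) c = F t a (F (t * s⁻¹) b c)
  cond4 : ∀ a : A, a = 0 ↔ ∀ (t : G) (b : A), F t a b = 0 ∧ F t b a = 0
  cond5a : ∀ (s t : G) (b : A), ∀ a ∈ α.ideal t⁻¹, F (s * t) a b = F s (α.act t a) b
  cond5b : ∀ (s t : G) (b : A), ∀ a ∈ α.ideal t⁻¹,
    α.act (s * t) (F (t⁻¹ * s⁻¹) b a) = α.act s (F s⁻¹ b (α.act t a))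
  cond6 : ∀ (t : G) (a : A),
    (∃ b : A, ∀ (s : G) (c : A), F s a c = F (s * t) b c ∧ F s c a = α.act t (F (t⁻¹ * s) c b)) →
    a ∈ α.ideal t

end PartialActionPrelim

section MultiplierPrelim

variable (k : Type u) [CommRing k] (M : Type x) [NonUnitalRing M]
  [Module k M] [SMulCommClass k M M] [IsScalarTower k M M]

/-- A multiplier of a non-unital algebra `M`: a pair `(L, R)` of linear maps with
`L(fg) = L(f)g`, `R(fg) = fR(g)` and `fL(g) = R(f)g`. -/
structure Multiplier : Type (max u x) where
  L : M →ₗ[k] M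
  R : M →ₗ[k] M
  L_mul : ∀ f g : M, L (f * g) = L f * g
  R_mul : ∀ f g : M, R (f * g) = f * R g
  cross : ∀ f g : M, f * L g = R f * g

namespace Multiplier

variable {k M}

@[ext] lemma ext {m n : Multiplier k M} (hL : m.L = n.L) (hR : m.R = n.R) : m = n := by
  cases m; cases n; simp_all

instance : Zero (Multiplier k M) :=
  ⟨⟨0, 0, by simp, by simp, by simp⟩⟩

instance : Add (Multiplier k M) :=
  ⟨fun m n =>
    ⟨m.L + n.L, m.R + n.R,
      by intro f g; simp [m.L_mul, n.L_mul, add_mul],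
      by intro f g; simp [m.R_mul, n.R_mul, mul_add],
      by intro f g; simp [m.cross, n.cross, mul_add, add_mul]⟩⟩

instance : Neg (Multiplier k M) :=
  ⟨fun m =>
    ⟨-m.L, -m.R,
      by intro f g; simp [m.L_mul, neg_mul],
      by intro f g; simp [m.R_mul, mul_neg],
      by intro f g; simp [m.cross, mul_neg, neg_mul]⟩⟩

instance : SMul k (Multiplier k M) :=
  ⟨fun c m =>
    ⟨c • m.L, c • m.R,
      by intro f g; simp [m.L_mul, smul_mul_assoc],
      by intro f g; simp [m.R_mul, mul_smul_comm],
      by intro f g; simp [m.cross, mul_smul_comm, smul_mul_assoc]⟩⟩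

instance : Mul (Multiplier k M) :=
  ⟨fun m n =>
    ⟨m.L ∘ₗ n.L, n.R ∘ₗ m.R,
      by intro f g; simp [n.L_mul, m.L_mul],
      by intro f g; simp [m.R_mul, n.R_mul],
      by intro f g; simp [m.cross, n.cross]⟩⟩

@[simp] lemma zero_L : (0 : Multiplier k M).L = 0 := rfl
@[simp] lemma zero_R : (0 : Multiplier k M).R = 0 := rfl
@[simp] lemma add_L (m n : Multiplier k M) : (m + n).L = m.L + n.L := rfl
@[simp] lemma add_R (m n : Multiplier k M) : (m + n).R = m.R + n.R := rfl
@[simp] lemma neg_L (m : Multiplier k M) : (-m).L = -m.L := rfl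
@[simp] lemma neg_R (m : Multiplier k M) : (-m).R = -m.R := rfl
@[simp] lemma smul_L (c : k) (m : Multiplier k M) : (c • m).L = c • m.L := rfl
@[simp] lemma smul_R (c : k) (m : Multiplier k M) : (c • m).R = c • m.R := rfl
@[simp] lemma mul_L (m n : Multiplier k M) : (m * n).L = m.L ∘ₗ n.L := rfl
@[simp] lemma mul_R (m n : Multiplier k M) : (m * n).R = n.R ∘ₗ m.R := rfl

instance : AddCommGroup (Multiplier k M) where
  add_assoc a b c := by ext <;> simp [add_assoc]
  zero_add a := by ext <;> simp
  add_zero a := by ext <;> simp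
  add_comm a b := by ext <;> simp [add_comm]
  neg_add_cancel a := by ext <;> simp
  nsmul := nsmulRec
  zsmul := zsmulRec

instance : Module k (Multiplier k M) where
  one_smul m := by ext <;> simp
  mul_smul c d m := by ext <;> simp [mul_smul]
  smul_zero c := by ext <;> simp
  smul_add c m n := by ext <;> simp
  add_smul c d m := by ext <;> simp [add_smul]
  zero_smul m := by ext <;> simp

end Multiplier

end MultiplierPrelim

section AdPrelim

variable (k : Type u) [CommRing k] (G : Type v) [Group G] (A : Type w)
  [NonUnitalRing A] [Module k A] [SMulCommClass k A A] [IsScalarTower k A A]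

/-- The left-translation representation `λ_s f (r) = f (s⁻¹ r)` of `G` on `F(G,A)`. -/
def lamRep (s : G) : (G → A) →ₗ[k] (G → A) where
  toFun f := fun r => f (s⁻¹ * r)
  map_add' f g := rfl
  map_smul' c f := rfl

@[simp] lemma lamRep_apply (s : G) (f : G → A) (r : G) : lamRep k G A s f r = f (s⁻¹ * r) := rfl

/-- The global action `Ad` of `G` on the multiplier algebra `M(F(G,A))`. -/
def AdAct (s : G) (m : Multiplier k (G → A)) : Multiplier k (G → A) where
  L := lamRep k G A s ∘ₗ m.L ∘ₗ lamRep k G A s⁻¹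
  R := lamRep k G A s ∘ₗ m.R ∘ₗ lamRep k G A s⁻¹
  L_mul f g := by
    have h : lamRep k G A s⁻¹ (f * g) = lamRep k G A s⁻¹ f * lamRep k G A s⁻¹ g := rfl
    funext r
    simp only [LinearMap.comp_apply, h, m.L_mul, lamRep_apply, Pi.mul_apply]
    simp
  R_mul f g := by
    have h : lamRep k G A s⁻¹ (f * g) = lamRep k G A s⁻¹ f * lamRep k G A s⁻¹ g := rfl
    funext r
    simp only [LinearMap.comp_apply, h, m.R_mul, lamRep_apply, Pi.mul_apply]
    simp
  cross f g := by
    have h := m.cross (lamRep k G A s⁻¹ f) (lamRep k G A s⁻¹ g)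
    funext r
    have h' := congrFun h (s⁻¹ * r)
    simp only [Pi.mul_apply, lamRep_apply, LinearMap.comp_apply] at h' ⊢
    simpa using h'

@[simp] lemma AdAct_L (s : G) (m : Multiplier k (G → A)) :
    (AdAct k G A s m).L = lamRep k G A s ∘ₗ m.L ∘ₗ lamRep k G A s⁻¹ := rfl
@[simp] lemma AdAct_R (s : G) (m : Multiplier k (G → A)) :
    (AdAct k G A s m).R = lamRep k G A s ∘ₗ m.R ∘ₗ lamRep k G A s⁻¹ := rfl

end AdPrelim

namespace EnvPair

variable {k : Type u} [CommRing k] {G : Type v} [Group G] {A : Type w}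
  [NonUnitalRing A] [Module k A] [SMulCommClass k A A] [IsScalarTower k A A]
  {α : AlgPartialAction k G A}
  {B : Type x} [NonUnitalRing B] [Module k B] [SMulCommClass k B B] [IsScalarTower k B B]
  (P : EnvPair α B)

lemma β_β_inv (r : G) (b : B) : P.β r (P.β r⁻¹ b) = b := by
  rw [← P.β_comp, mul_inv_cancel, P.β_one]

lemma β_inv_β (r : G) (b : B) : P.β r⁻¹ (P.β r b) = b := by
  rw [← P.β_comp, inv_mul_cancel, P.β_one]

lemma β_inv_mul_eq_zero_iff (r : G) (b c : B) : P.β r⁻¹ b * c = 0 ↔ b * P.β r c = 0 := by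
  constructor <;> intro h
  · rw [← P.β_β_inv r b, ← map_mul, h, map_zero]
  · rw [← P.β_inv_β r c, ← map_mul, h, map_zero]

lemma mul_β_inv_eq_zero_iff (r : G) (b c : B) : c * P.β r⁻¹ b = 0 ↔ P.β r c * b = 0 := by
  constructor <;> intro h
  · rw [← P.β_β_inv r b, ← map_mul, h, map_zero]
  · rw [← P.β_inv_β r c, ← map_mul, h, map_zero]

/-- Membership in `Ann(B)` may be tested on the spanning translates `β_r(μ(A))`. -/
lemma mem_annih_iff (b : B) :
    b ∈ annih B ↔ ∀ (r : G) (a : A), b * P.β r (P.μ a) = 0 ∧ P.β r (P.μ a) * b = 0 := by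
  refine ⟨fun h r a => h _, fun h c => ?_⟩
  have hc : c ∈ Submodule.span k (⋃ t : G, ⇑(P.β t) '' Set.range P.μ) := by
    rw [P.spans]; trivial
  induction hc using Submodule.span_induction with
  | mem c hc =>
    obtain ⟨t, _, ⟨a, rfl⟩, rfl⟩ := Set.mem_iUnion.1 hc
    exact h t a
  | zero => simp
  | add c d _ _ hc hd => simp [mul_add, add_mul, hc, hd]
  | smul r c _ hc => simp [mul_smul_comm, smul_mul_assoc, hc]

end EnvPair

/-- If `(μ, β)` is an enveloping pair of a partial action `α` of `G` on a
`k`-algebra `A`, acting on `B`, and `π : B → M(F(G,A))` is the canonical map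
`(π(b)f)(r) = μ⁻¹(β_{r⁻¹}(b)·μ(f(r)))`, `(fπ(b))(r) = μ⁻¹(μ(f(r))·β_{r⁻¹}(b))`,
then `Ker(π) = Ann(B)`. -/
theorem kernel_pi_eq_annihilator
    {k : Type u} [CommRing k] {G : Type v} [Group G] {A : Type w}
    [NonUnitalRing A] [Module k A] [SMulCommClass k A A] [IsScalarTower k A A]
    (α : AlgPartialAction k G A)
    {B : Type x} [NonUnitalRing B] [Module k B] [SMulCommClass k B B] [IsScalarTower k B B]
    (P : EnvPair α B) (π : B → Multiplier k (G → A))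
    (hπ : ∀ (b : B) (f : G → A) (r : G),
      P.μ ((π b).L f r) = P.β r⁻¹ b * P.μ (f r) ∧
      P.μ ((π b).R f r) = P.μ (f r) * P.β r⁻¹ b) :
    {b : B | π b = 0} = annih B := by
  ext b
  rw [P.mem_annih_iff, Set.mem_ofPred_eq]
  constructor
  · intro h r a
    obtain ⟨hL, hR⟩ := hπ b (fun _ => a) r
    simp only [h, Multiplier.zero_L, Multiplier.zero_R, LinearMap.zero_apply, Pi.zero_apply,
      map_zero] at hL hR
    exact ⟨(P.β_inv_mul_eq_zero_iff r b _).1 hL.symm, (P.mul_β_inv_eq_zero_iff r b _).1 hR.symm⟩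
  · intro h
    ext f r
    · apply P.μ_inj
      simpa [(hπ b f r).1] using (P.β_inv_mul_eq_zero_iff r b _).2 (h r (f r)).1
    · apply P.μ_inj
      simpa [(hπ b f r).2] using (P.mul_β_inv_eq_zero_iff r b _).2 (h r (f r)).2
end

section
/- Let α be a partial action of a group G on a k-algebra A and (μ, β) an enveloping pair of α acting on B. Then π is a morphism of actions from β to Ad: π : B → M(F(G,A)) is an algebra homomorphism satisfying π(β_t(b)) = Ad_t(π(b)) for all t ∈ G and b ∈ B. Consequently π(B) is an Ad-invariant subalgebra of M(F(G,A)), π(μ(A)) is an ideal of π(B), and span{Ad_t(π(μ(A))) : t ∈ G} = π(B). -/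
set_option linter.unusedSectionVars false
set_option linter.unusedVariables false

universe u v w x y

/-- A multiplier is determined by its components after composing with an injective map. -/
lemma Multiplier.ext_of_injective {k : Type u} [CommRing k] {G : Type v} {A : Type w}
    [NonUnitalRing A] [Module k A] [SMulCommClass k A A] [IsScalarTower k A A]
    {B : Type x} {μ : A → B} (hμ : Function.Injective μ) {m n : Multiplier k (G → A)}
    (h : ∀ f r, μ (m.L f r) = μ (n.L f r) ∧ μ (m.R f r) = μ (n.R f r)) : m = n := by
  refine Multiplier.ext (LinearMap.ext fun f => funext fun r => hμ (h f r).1)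
    (LinearMap.ext fun f => funext fun r => hμ (h f r).2)

/-- For an enveloping pair `(μ, β)` of `α` acting on `B`, the canonical map
`π : B → M(F(G,A))` is a morphism of actions from `β` to `Ad`: it is an algebra homomorphism
intertwining `β` and `Ad`. Consequently `π(B)` is an `Ad`-invariant subalgebra of `M(F(G,A))`,
`π(μ(A))` is an ideal of `π(B)`, and `span {Ad_t(π(μ(A))) : t ∈ G} = π(B)`. -/
theorem pi_morphism_of_actions
    {k : Type u} [CommRing k] {G : Type v} [Group G] {A : Type w}
    [NonUnitalRing A] [Module k A] [SMulCommClass k A A] [IsScalarTower k A A]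
    (α : AlgPartialAction k G A)
    {B : Type x} [NonUnitalRing B] [Module k B] [SMulCommClass k B B] [IsScalarTower k B B]
    (P : EnvPair α B) (π : B → Multiplier k (G → A))
    (hπ : ∀ (b : B) (f : G → A) (r : G),
      P.μ ((π b).L f r) = P.β r⁻¹ b * P.μ (f r) ∧
      P.μ ((π b).R f r) = P.μ (f r) * P.β r⁻¹ b) :
    -- π is an algebra homomorphism
    (∀ b b' : B, π (b + b') = π b + π b') ∧
    (∀ (c : k) (b : B), π (c • b) = c • π b) ∧
    (∀ b b' : B, π (b * b') = π b * π b') ∧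
    -- π is a morphism of actions from β to Ad
    (∀ (t : G) (b : B), π (P.β t b) = AdAct k G A t (π b)) ∧
    -- π(B) is an Ad-invariant subalgebra
    (∀ t : G, AdAct k G A t '' Set.range π = Set.range π) ∧
    (∀ x ∈ Set.range π, ∀ y ∈ Set.range π,
      x + y ∈ Set.range π ∧ x * y ∈ Set.range π) ∧
    (∀ (c : k), ∀ x ∈ Set.range π, c • x ∈ Set.range π) ∧
    -- π(μ(A)) is an ideal of π(B)
    (∀ x ∈ Set.range (fun a : A => π (P.μ a)), ∀ y ∈ Set.range π,
      x * y ∈ Set.range (fun a : A => π (P.μ a)) ∧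
      y * x ∈ Set.range (fun a : A => π (P.μ a))) ∧
    -- span {Ad_t(π(μ(A))) : t ∈ G} = π(B)
    (Submodule.span k (⋃ t : G, AdAct k G A t '' Set.range (fun a : A => π (P.μ a)))
      : Set (Multiplier k (G → A))) = Set.range π := by
  have hL b f r := (hπ b f r).1
  have hR b f r := (hπ b f r).2
  have hadd : ∀ b b' : B, π (b + b') = π b + π b' := fun b b' =>
    Multiplier.ext_of_injective P.μ_inj fun f r => by simp [hL, hR, add_mul, mul_add]
  have hsmul : ∀ (c : k) (b : B), π (c • b) = c • π b := fun c b =>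
    Multiplier.ext_of_injective P.μ_inj fun f r => by
      simp [hL, hR, smul_mul_assoc, mul_smul_comm]
  have hmul : ∀ b b' : B, π (b * b') = π b * π b' := fun b b' =>
    Multiplier.ext_of_injective P.μ_inj fun f r => by simp [hL, hR, mul_assoc]
  have hAd : ∀ (t : G) (b : B), π (P.β t b) = AdAct k G A t (π b) := fun t b =>
    Multiplier.ext_of_injective P.μ_inj fun f r => by simp [hL, hR, P.β_comp]
  refine ⟨hadd, hsmul, hmul, hAd, fun t => ?_, ?_, ?_, ?_, ?_⟩
  · ext m
    constructor
    · rintro ⟨_, ⟨b, rfl⟩, rfl⟩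
      exact ⟨P.β t b, hAd t b⟩
    · rintro ⟨b, rfl⟩
      refine ⟨_, ⟨P.β t⁻¹ b, rfl⟩, ?_⟩
      rw [← hAd, ← P.β_comp, mul_inv_cancel, P.β_one]
  · rintro _ ⟨b, rfl⟩ _ ⟨b', rfl⟩
    exact ⟨⟨b + b', hadd b b'⟩, ⟨b * b', hmul b b'⟩⟩
  · rintro c _ ⟨b, rfl⟩
    exact ⟨c • b, hsmul c b⟩
  · rintro _ ⟨a, rfl⟩ _ ⟨b, rfl⟩
    obtain ⟨a₁, h₁⟩ := P.μ_mul_mem_right b _ ⟨a, rfl⟩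
    obtain ⟨a₂, h₂⟩ := P.μ_mul_mem_left b _ ⟨a, rfl⟩
    exact ⟨⟨a₁, by simp only [h₁, hmul]⟩, ⟨a₂, by simp only [h₂, hmul]⟩⟩
  · let πₗ : B →ₗ[k] Multiplier k (G → A) :=
      { toFun := π, map_add' := hadd, map_smul' := hsmul }
    have himage : (⋃ t : G, AdAct k G A t '' Set.range (fun a : A => π (P.μ a)))
        = πₗ '' ⋃ t : G, ⇑(P.β t) '' Set.range P.μ := by
      rw [Set.image_iUnion]
      refine Set.iUnion_congr fun t => ?_
      simp only [← Set.range_comp]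
      exact congrArg Set.range (funext fun a => (hAd t (P.μ a)).symm)
    rw [himage, Submodule.span_image, P.spans, Submodule.map_top, LinearMap.coe_range]
    rfl
end

section
/- Let α be a partial action of a group G on a k-algebra A and (μ, β) an enveloping pair of α acting on B with Ann(B) = {0}. Then the adjoint pair (μ', Ad') is an enveloping pair of α, and π : B → π(B) is an isomorphism of enveloping pairs from (μ, β) to (μ', Ad') (i.e. π is an algebra isomorphism, π ∘ β_t = Ad'_t ∘ π for all t, and π ∘ μ = μ'). -/
set_option linter.unusedSectionVars false
set_option linter.unusedVariables false

universe u v w x y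

section AdjointPair

variable {k : Type u} [CommRing k] {G : Type v} [Group G] {A : Type w}
  [NonUnitalRing A] [Module k A] [SMulCommClass k A A] [IsScalarTower k A A]
  {α : AlgPartialAction k G A}
  {B : Type x} [NonUnitalRing B] [Module k B] [SMulCommClass k B B] [IsScalarTower k B B]

namespace EnvPair

lemma β_inv_apply (P : EnvPair α B) (t : G) (b : B) : P.β t (P.β t⁻¹ b) = b := by
  rw [← P.β_comp, mul_inv_cancel, P.β_one]

/-- Multipliers of `F(G, A)` can be compared after applying the embedding `μ` pointwise. -/
lemma multiplier_ext (P : EnvPair α B) {m n : Multiplier k (G → A)}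
    (h : ∀ (f : G → A) (r : G),
      P.μ (m.L f r) = P.μ (n.L f r) ∧ P.μ (m.R f r) = P.μ (n.R f r)) : m = n :=
  Multiplier.ext
    (LinearMap.ext fun f => funext fun r => P.μ_inj (h f r).1)
    (LinearMap.ext fun f => funext fun r => P.μ_inj (h f r).2)

/-- Every element of `B` is determined, modulo `Ann(B)`, by its products with the translates of
`μ(A)`. -/
lemma mem_annih_of_forall_β (P : EnvPair α B) {b : B}
    (h : ∀ (r : G) (a : A), P.β r⁻¹ b * P.μ a = 0 ∧ P.μ a * P.β r⁻¹ b = 0) : b ∈ annih B := by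
  intro c
  have hc : c ∈ Submodule.span k (⋃ t : G, ⇑(P.β t) '' Set.range P.μ) := by
    rw [P.spans]; trivial
  induction hc using Submodule.span_induction with
  | mem y hy =>
    obtain ⟨r, -, ⟨a, rfl⟩, rfl⟩ := Set.mem_iUnion.mp hy
    have h₁ := congrArg (P.β r) (h r a).1
    have h₂ := congrArg (P.β r) (h r a).2
    rw [map_mul, map_zero, P.β_inv_apply] at h₁ h₂
    exact ⟨h₁, h₂⟩
  | zero => simp
  | add y z _ _ hy hz => simp [mul_add, add_mul, hy, hz]
  | smul c y _ hy => simp [mul_smul_comm, smul_mul_assoc, hy]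

/-- `π` is the canonical map `B → M(F(G, A))` of the enveloping pair `P`. -/
def IsCanonical (P : EnvPair α B) (π : B → Multiplier k (G → A)) : Prop :=
  ∀ (b : B) (f : G → A) (r : G),
    P.μ ((π b).L f r) = P.β r⁻¹ b * P.μ (f r) ∧ P.μ ((π b).R f r) = P.μ (f r) * P.β r⁻¹ b

namespace IsCanonical

variable {P : EnvPair α B} {π : B → Multiplier k (G → A)}

lemma map_add (h : P.IsCanonical π) (b b' : B) : π (b + b') = π b + π b' :=
  P.multiplier_ext fun f r => by simp [(h _ f r).1, (h _ f r).2, add_mul, mul_add]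

lemma map_smul (h : P.IsCanonical π) (c : k) (b : B) : π (c • b) = c • π b :=
  P.multiplier_ext fun f r => by
    simp [(h _ f r).1, (h _ f r).2, smul_mul_assoc, mul_smul_comm]

lemma map_mul (h : P.IsCanonical π) (b b' : B) : π (b * b') = π b * π b' :=
  P.multiplier_ext fun f r => by simp [(h _ _ r).1, (h _ _ r).2, mul_assoc]

lemma map_β (h : P.IsCanonical π) (t : G) (b : B) : π (P.β t b) = AdAct k G A t (π b) :=
  P.multiplier_ext fun f r => by simp [(h _ _ _).1, (h _ _ _).2, P.β_comp]

/-- The canonical map as a linear map. -/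
def toLinearMap (h : P.IsCanonical π) : B →ₗ[k] Multiplier k (G → A) where
  toFun := π
  map_add' := h.map_add
  map_smul' := h.map_smul

@[simp] lemma coe_toLinearMap (h : P.IsCanonical π) : ⇑h.toLinearMap = π := rfl

lemma injective (h : P.IsCanonical π) (hAnn : annih B = {0}) : Function.Injective π := by
  rw [← h.coe_toLinearMap, injective_iff_map_eq_zero]
  intro b hb
  have hb' : b ∈ annih B := P.mem_annih_of_forall_β fun r a => by
    have h₁ := h b (fun _ => a) r
    rw [show π b = 0 from hb] at h₁
    simpa [eq_comm] using h₁
  rwa [hAnn] at hb'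

lemma AdAct_image (h : P.IsCanonical π) (t : G) (S : Set B) :
    AdAct k G A t '' (π '' S) = π '' (P.β t '' S) := by
  simp only [Set.image_image, h.map_β]

lemma AdAct_range (h : P.IsCanonical π) (t : G) :
    AdAct k G A t '' Set.range π = Set.range π := by
  have hβ : Function.Surjective (P.β t) := fun b => ⟨_, P.β_inv_apply t b⟩
  rw [← Set.image_univ, h.AdAct_image, Set.image_univ_of_surjective hβ]

lemma span_AdAct (h : P.IsCanonical π) :
    (Submodule.span k (⋃ t : G, AdAct k G A t '' (π '' Set.range P.μ)) :
      Set (Multiplier k (G → A))) = Set.range π := by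
  simp only [h.AdAct_image]
  rw [← Set.image_iUnion, ← h.coe_toLinearMap, Submodule.span_image, P.spans, Submodule.map_top,
    LinearMap.coe_range]

lemma image_ideal (h : P.IsCanonical π) (hAnn : annih B = {0}) (t : G) :
    π '' (P.μ '' (α.ideal t : Set A)) =
      π '' Set.range P.μ ∩ AdAct k G A t '' (π '' Set.range P.μ) := by
  rw [h.AdAct_image, P.inter, Set.image_inter (h.injective hAnn)]

end IsCanonical

end EnvPair

end AdjointPair

/-- If `(μ, β)` is an enveloping pair of `α` acting on `B` with `Ann(B) = 0`,
then the adjoint pair `(μ', Ad')` (where `μ' = π ∘ μ` and `Ad'` is the restriction of `Ad` to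
`π(B)`) is again an enveloping pair of `α`, and `π : B → π(B)` is an isomorphism of enveloping
pairs from `(μ, β)` to `(μ', Ad')`. -/
theorem adjoint_pair_is_enveloping_of_trivial_annihilator
    {k : Type u} [CommRing k] {G : Type v} [Group G] {A : Type w}
    [NonUnitalRing A] [Module k A] [SMulCommClass k A A] [IsScalarTower k A A]
    (α : AlgPartialAction k G A)
    {B : Type x} [NonUnitalRing B] [Module k B] [SMulCommClass k B B] [IsScalarTower k B B]
    (P : EnvPair α B) (hAnn : annih B = {0})
    (π : B → Multiplier k (G → A))
    (hπ : ∀ (b : B) (f : G → A) (r : G),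
      P.μ ((π b).L f r) = P.β r⁻¹ b * P.μ (f r) ∧
      P.μ ((π b).R f r) = P.μ (f r) * P.β r⁻¹ b) :
    -- `(μ', Ad')` is an enveloping pair of `α` on the algebra `π(B)`:
    -- μ' := π ∘ μ is an injective algebra homomorphism,
    (Function.Injective fun a : A => π (P.μ a)) ∧
    (∀ a a' : A, π (P.μ (a + a')) = π (P.μ a) + π (P.μ a')) ∧
    (∀ (c : k) (a : A), π (P.μ (c • a)) = c • π (P.μ a)) ∧
    (∀ a a' : A, π (P.μ (a * a')) = π (P.μ a) * π (P.μ a')) ∧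
    -- μ'(A) is an ideal of π(B),
    (∀ x ∈ Set.range (fun a : A => π (P.μ a)), ∀ y ∈ Set.range π,
      x * y ∈ Set.range (fun a : A => π (P.μ a)) ∧
      y * x ∈ Set.range (fun a : A => π (P.μ a))) ∧
    -- μ'(A_t) = μ'(A) ∩ Ad'_t(μ'(A)),
    (∀ t : G, (fun a : A => π (P.μ a)) '' (α.ideal t : Set A) =
      Set.range (fun a : A => π (P.μ a)) ∩
        (AdAct k G A t '' Set.range (fun a : A => π (P.μ a)))) ∧
    -- Ad'_t ∘ μ' = μ' ∘ α_t on A_{t⁻¹},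
    (∀ t : G, ∀ a ∈ α.ideal t⁻¹, AdAct k G A t (π (P.μ a)) = π (P.μ (α.act t a))) ∧
    -- π(B) is Ad-invariant and is spanned by the orbit of μ'(A),
    (∀ t : G, AdAct k G A t '' Set.range π = Set.range π) ∧
    ((Submodule.span k (⋃ t : G, AdAct k G A t '' Set.range (fun a : A => π (P.μ a)))
      : Set (Multiplier k (G → A))) = Set.range π) ∧
    -- and π : B → π(B) is an isomorphism of enveloping pairs from (μ, β) to (μ', Ad'):
    Function.Injective π ∧
    (∀ b b' : B, π (b + b') = π b + π b') ∧
    (∀ (c : k) (b : B), π (c • b) = c • π b) ∧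
    (∀ b b' : B, π (b * b') = π b * π b') ∧
    (∀ (t : G) (b : B), π (P.β t b) = AdAct k G A t (π b)) := by
  have h : P.IsCanonical π := hπ
  have hrange : Set.range (fun a : A => π (P.μ a)) = π '' Set.range P.μ := Set.range_comp π P.μ
  simp only [hrange]
  refine ⟨(h.injective hAnn).comp P.μ_inj, fun a a' => by rw [map_add, h.map_add],
    fun c a => by rw [map_smul, h.map_smul], fun a a' => by rw [map_mul, h.map_mul], ?_,
    fun t => by rw [← h.image_ideal hAnn, Set.image_image],
    fun t a ha => by rw [← h.map_β, P.equivar t a ha], h.AdAct_range, h.span_AdAct,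
    h.injective hAnn, h.map_add, h.map_smul, h.map_mul, h.map_β⟩
  rintro _ ⟨x, hx, rfl⟩ _ ⟨y, rfl⟩
  exact ⟨⟨x * y, P.μ_mul_mem_right y x hx, h.map_mul x y⟩,
    ⟨y * x, P.μ_mul_mem_left y x hx, h.map_mul y x⟩⟩
end

section
/- Let α be a partial action of a group G on a k-algebra A. Every enveloping family of functions for α is the family associated to some enveloping pair of α with trivial annihilator. Moreover, two enveloping pairs of α with trivial annihilator are isomorphic if and only if their associated families of functions are equal. -/
set_option linter.unusedSectionVars false
set_option linter.unusedVariables false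

universe u v w x y

/-- Packaged enveloping pair: an algebra together with an enveloping pair of `α` on it. -/
structure EnvelopingOf {k : Type u} [CommRing k] {G : Type v} [Group G] {A : Type w}
    [NonUnitalRing A] [Module k A] [SMulCommClass k A A] [IsScalarTower k A A]
    (α : AlgPartialAction k G A) : Type (max u v w + 1) where
  carrier : Type (max u v w)
  [ringI : NonUnitalRing carrier]
  [modI : Module k carrier]
  [sccI : SMulCommClass k carrier carrier]
  [istI : IsScalarTower k carrier carrier]
  pair : EnvPair α carrier

section AssociatedFamily

variable {k : Type u} [CommRing k] {G : Type v} [Group G] {A : Type w}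
  [NonUnitalRing A] [Module k A] [SMulCommClass k A A] [IsScalarTower k A A]
  {α : AlgPartialAction k G A}

namespace EnvPair

variable {B : Type x} [NonUnitalRing B] [Module k B] [SMulCommClass k B B] [IsScalarTower k B B]
  (P : EnvPair α B)

lemma β_apply_inv (t : G) (b : B) : P.β t (P.β t⁻¹ b) = b := by
  rw [← P.β_comp, mul_inv_cancel, P.β_one]

/-- The elements `β_t (μ a)` generate `B` as a module. -/
lemma induction_on {p : B → Prop} (b : B) (gen : ∀ t a, p (P.β t (P.μ a))) (zero : p 0)
    (add : ∀ x y, p x → p y → p (x + y)) (smul : ∀ (c : k) x, p x → p (c • x)) : p b := by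
  have hb : b ∈ Submodule.span k (⋃ t : G, ⇑(P.β t) '' Set.range P.μ) := by
    rw [P.spans]; trivial
  induction hb using Submodule.span_induction with
  | mem x hx =>
    obtain ⟨t, -, ⟨a, rfl⟩, rfl⟩ := Set.mem_iUnion.mp hx
    exact gen t a
  | zero => exact zero
  | add x y _ _ hx hy => exact add x y hx hy
  | smul c x _ hx => exact smul c x hx

lemma eq_zero_of_mul_μ (hB : annih B = {0}) {b : B}
    (h : ∀ s c, P.β s b * P.μ c = 0 ∧ P.μ c * P.β s b = 0) : b = 0 := by
  suffices b ∈ annih B by rwa [hB] at this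
  intro x
  induction x using P.induction_on with
  | gen t a =>
    constructor
    · rw [← P.β_apply_inv t b, ← map_mul, (h t⁻¹ a).1, map_zero]
    · rw [← P.β_apply_inv t b, ← map_mul, (h t⁻¹ a).2, map_zero]
  | zero => simp
  | add x y hx hy => simp [mul_add, add_mul, hx.1, hx.2, hy.1, hy.2]
  | smul c x hx => simp [mul_smul_comm, smul_mul_assoc, hx.1, hx.2]

/-- The linear map `(a_t)_t ↦ ∑ t, β_t (μ a_t)`. -/
noncomputable def sumMap : (G →₀ A) →ₗ[k] B :=
  Finsupp.lsum k fun t => (P.β t : B →ₗ[k] B) ∘ₗ (P.μ : A →ₗ[k] B)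

lemma sumMap_apply (f : G →₀ A) : P.sumMap f = f.sum fun t a => P.β t (P.μ a) := rfl

@[simp] lemma sumMap_single (t : G) (a : A) :
    P.sumMap (Finsupp.single t a) = P.β t (P.μ a) := by
  simp [sumMap_apply]

lemma sumMap_surjective : Function.Surjective P.sumMap := by
  intro b
  induction b using P.induction_on with
  | gen t a => exact ⟨_, P.sumMap_single t a⟩
  | zero => exact ⟨0, map_zero _⟩
  | add x y hx hy =>
    obtain ⟨f, rfl⟩ := hx
    obtain ⟨g, rfl⟩ := hy
    exact ⟨f + g, map_add _ _ _⟩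
  | smul c x hx =>
    obtain ⟨f, rfl⟩ := hx
    exact ⟨c • f, map_smul _ _ _⟩

variable {F : G → A → A → A}

lemma family_mem (hF : ∀ t a b, P.μ (F t a b) = P.β t (P.μ a) * P.μ b)
    (t : G) (a b : A) : F t a b ∈ α.ideal t := by
  have h : P.μ (F t a b) ∈ ⇑P.μ '' (α.ideal t : Set A) := by
    rw [P.inter]
    refine ⟨⟨_, rfl⟩, ?_⟩
    obtain ⟨c, hc⟩ := P.μ_mul_mem_right (P.β t⁻¹ (P.μ b)) (P.μ a) ⟨a, rfl⟩
    exact ⟨P.μ c, ⟨c, rfl⟩, by rw [hc, map_mul, P.β_apply_inv, hF]⟩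
  obtain ⟨c, hc, hcF⟩ := h
  exact P.μ_inj hcF ▸ hc

lemma μ_act_family (hF : ∀ t a b, P.μ (F t a b) = P.β t (P.μ a) * P.μ b)
    (t : G) (a b : A) :
    P.μ (α.act t (F t⁻¹ a b)) = P.μ a * P.β t (P.μ b) := by
  rw [← P.equivar t _ (P.family_mem hF _ _ _), hF, map_mul, P.β_apply_inv]

lemma β_mul_β (hF : ∀ t a b, P.μ (F t a b) = P.β t (P.μ a) * P.μ b)
    (s t : G) (a b : A) :
    P.β s (P.μ a) * P.β t (P.μ b) = P.β t (P.μ (F (t⁻¹ * s) a b)) := by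
  rw [hF, map_mul, ← P.β_comp, mul_inv_cancel_left]

lemma sumMap_eq_zero_iff (hF : ∀ t a b, P.μ (F t a b) = P.β t (P.μ a) * P.μ b)
    (hB : annih B = {0}) (f : G →₀ A) :
    P.sumMap f = 0 ↔ ∀ s c, (f.sum fun t a => F (s * t) a c) = 0 ∧
      (f.sum fun t a => α.act (s * t) (F (s * t)⁻¹ c a)) = 0 := by
  have hL (s : G) (c : A) :
      P.μ (f.sum fun t a => F (s * t) a c) = P.β s (P.sumMap f) * P.μ c := by
    simp only [sumMap_apply, Finsupp.sum, map_sum, Finset.sum_mul, hF, P.β_comp]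
  have hR (s : G) (c : A) : P.μ (f.sum fun t a => α.act (s * t) (F (s * t)⁻¹ c a)) =
      P.μ c * P.β s (P.sumMap f) := by
    simp only [sumMap_apply, Finsupp.sum, map_sum, Finset.mul_sum, P.μ_act_family hF, P.β_comp]
  constructor
  · intro h s c
    constructor <;> apply P.μ_inj
    · rw [hL, h, map_zero, map_zero, zero_mul]
    · rw [hR, h, map_zero, map_zero, mul_zero]
  · intro h
    refine P.eq_zero_of_mul_μ hB fun s c => ⟨?_, ?_⟩
    · rw [← hL, (h s c).1, map_zero]
    · rw [← hR, (h s c).2, map_zero]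

end EnvPair

variable {B : Type x} [NonUnitalRing B] [Module k B] [SMulCommClass k B B] [IsScalarTower k B B]
  {C : Type y} [NonUnitalRing C] [Module k C] [SMulCommClass k C C] [IsScalarTower k C C]
  {P : EnvPair α B} {Q : EnvPair α C}

lemma IsEnvPairIso.family_eq {φ : B → C} (hφ : IsEnvPairIso P Q φ) {FP FQ : G → A → A → A}
    (hP : ∀ t a b, P.μ (FP t a b) = P.β t (P.μ a) * P.μ b)
    (hQ : ∀ t a b, Q.μ (FQ t a b) = Q.β t (Q.μ a) * Q.μ b) : FP = FQ := by
  obtain ⟨-, -, hmul, -, hβ, hμ⟩ := hφ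
  funext t a b
  apply Q.μ_inj
  rw [hQ, ← hμ, hP, hmul, hβ, hμ, hμ]

lemma EnvPair.exists_iso_of_family_eq (hB : annih B = {0}) (hC : annih C = {0})
    {F : G → A → A → A} (hP : ∀ t a b, P.μ (F t a b) = P.β t (P.μ a) * P.μ b)
    (hQ : ∀ t a b, Q.μ (F t a b) = Q.β t (Q.μ a) * Q.μ b) :
    ∃ φ : B → C, IsEnvPairIso P Q φ := by
  have hker : LinearMap.ker P.sumMap = LinearMap.ker Q.sumMap := by
    ext f
    rw [LinearMap.mem_ker, LinearMap.mem_ker, P.sumMap_eq_zero_iff hP hB,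
      Q.sumMap_eq_zero_iff hQ hC]
  let φ : B ≃ₗ[k] C := (P.sumMap.quotKerEquivOfSurjective P.sumMap_surjective).symm ≪≫ₗ
    Submodule.quotEquivOfEq _ _ hker ≪≫ₗ Q.sumMap.quotKerEquivOfSurjective Q.sumMap_surjective
  have hφ (f : G →₀ A) : φ (P.sumMap f) = Q.sumMap f := by
    have h : (P.sumMap.quotKerEquivOfSurjective P.sumMap_surjective).symm (P.sumMap f) =
        Submodule.Quotient.mk f := by
      rw [LinearEquiv.symm_apply_eq]
      rfl
    simp only [φ, LinearEquiv.trans_apply, h]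
    rfl
  have hgen (t : G) (a : A) : φ (P.β t (P.μ a)) = Q.β t (Q.μ a) := by
    rw [← P.sumMap_single, hφ, Q.sumMap_single]
  refine ⟨φ, φ.bijective, map_add φ, fun x y => ?_, map_smul φ, fun t b => ?_, fun a => ?_⟩
  · induction x using P.induction_on with
    | gen s a =>
      induction y using P.induction_on with
      | gen t b => rw [P.β_mul_β hP, hgen, hgen, hgen, Q.β_mul_β hQ]
      | zero => simp
      | add x y hx hy => simp [mul_add, hx, hy]
      | smul c x hx => simp [mul_smul_comm, hx]
    | zero => simp
    | add x y hx hy => simp [add_mul, hx, hy]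
    | smul c x hx => simp [smul_mul_assoc, hx]
  · induction b using P.induction_on with
    | gen s a => rw [hgen, ← P.β_comp, ← Q.β_comp, hgen]
    | zero => simp
    | add x y hx hy => simp [hx, hy]
    | smul c x hx => simp [hx]
  · simpa only [P.β_one, Q.β_one] using hgen 1 a

end AssociatedFamily

namespace AlgPartialAction

variable {k : Type u} [CommRing k] {G : Type v} [Group G] {A : Type w}
  [NonUnitalRing A] [Module k A] [SMulCommClass k A A] [IsScalarTower k A A]
  (α : AlgPartialAction k G A)

lemma act_zero (t : G) : α.act t 0 = 0 := by
  simpa using α.act_smul t 0 0 (zero_mem _)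

lemma act_inv_mem {t : G} {a : A} (ha : a ∈ α.ideal t) : α.act t⁻¹ a ∈ α.ideal t⁻¹ :=
  α.act_mem t⁻¹ a (by rwa [inv_inv])

lemma act_act_inv {t : G} {a : A} (ha : a ∈ α.ideal t) : α.act t (α.act t⁻¹ a) = a := by
  rw [α.act_comp t t⁻¹ a (by rwa [inv_inv]) (α.act_inv_mem ha), mul_inv_cancel, α.act_one]

end AlgPartialAction

namespace IsEnvFamily

variable {k : Type u} [CommRing k] {G : Type v} [Group G] {A : Type w}
  [NonUnitalRing A] [Module k A] [SMulCommClass k A A] [IsScalarTower k A A]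
  {α : AlgPartialAction k G A} {F : G → A → A → A}

variable (k G A) in
/-- Functions on `G` with values in pairs `(L, R)` of endomorphisms of `A`, where `L` composes
as a left multiplication and `R` as a right multiplication. -/
abbrev Ambient : Type (max u v w) :=
  ULift.{u} G → Module.End k A × (Module.End k A)ᵐᵒᵖ

variable (k A) in
/-- The global action of `G` on the ambient algebra by translation. -/
def translate (s : G) : Ambient k G A →ₙₐ[k] Ambient k G A where
  toFun m := fun r => m ⟨s⁻¹ * r.down⟩
  map_smul' _ _ := rfl
  map_zero' := rfl
  map_add' _ _ := rfl
  map_mul' _ _ := rfl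

@[simp] lemma translate_apply (s : G) (m : Ambient k G A) (r : ULift.{u} G) :
    translate k A s m r = m ⟨s⁻¹ * r.down⟩ := rfl

lemma translate_one (m : Ambient k G A) : translate k A 1 m = m := by
  funext r; simp

lemma translate_mul (s t : G) (m : Ambient k G A) :
    translate k A (s * t) m = translate k A s (translate k A t m) := by
  funext r; simp [mul_assoc]

lemma ambient_ext {m n : Ambient k G A} (hL : ∀ r x, (m ⟨r⟩).1 x = (n ⟨r⟩).1 x)
    (hR : ∀ r x, (m ⟨r⟩).2.unop x = (n ⟨r⟩).2.unop x) : m = n := by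
  funext ⟨r⟩
  exact Prod.ext (LinearMap.ext (hL r)) (MulOpposite.unop_injective (LinearMap.ext (hR r)))

lemma inv_mem (h : IsEnvFamily α F) (t : G) (a b : A) : F t a b ∈ α.ideal t⁻¹⁻¹ := by
  rw [inv_inv]; exact h.mem t a b

variable (h : IsEnvFamily α F)

/-- The element `a` of `A` acting at `r` as multiplication by `β_{r⁻¹}(a)`. -/
def embed : A →ₗ[k] Ambient k G A where
  toFun a := fun r =>
    ({ toFun := fun x => F r.down⁻¹ a x
       map_add' := h.add_right _ _
       map_smul' := fun c x => h.smul_right _ c _ x },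
     MulOpposite.op
     { toFun := fun x => α.act r.down⁻¹ (F r.down x a)
       map_add' := fun x y => by
        rw [h.add_left, α.act_add _ _ (h.inv_mem _ _ _) _ (h.inv_mem _ _ _)]
       map_smul' := fun c x => by
        rw [h.smul_left, α.act_smul _ _ _ (h.inv_mem _ _ _), RingHom.id_apply] })
  map_add' a b := ambient_ext (fun r x => h.add_left _ _ _ _) fun r x => by
    change α.act r⁻¹ (F r x (a + b)) = α.act r⁻¹ (F r x a) + α.act r⁻¹ (F r x b)
    rw [h.add_right, α.act_add _ _ (h.inv_mem _ _ _) _ (h.inv_mem _ _ _)]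
  map_smul' c a := ambient_ext (fun r x => h.smul_left _ _ _ _) fun r x => by
    change α.act r⁻¹ (F r x (c • a)) = c • α.act r⁻¹ (F r x a)
    rw [h.smul_right, α.act_smul _ _ _ (h.inv_mem _ _ _)]

@[simp] lemma embed_fst (a x : A) (r : G) : (h.embed a ⟨r⟩).1 x = F r⁻¹ a x := rfl

@[simp] lemma embed_snd (a x : A) (r : G) :
    (h.embed a ⟨r⟩).2.unop x = α.act r⁻¹ (F r x a) := rfl

lemma embed_injective : Function.Injective h.embed := by
  rw [← LinearMap.ker_eq_bot, LinearMap.ker_eq_bot']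
  intro a ha
  refine (h.cond4 a).2 fun t b => ⟨?_, ?_⟩
  · simpa [ha, eq_comm] using h.embed_fst a b t⁻¹
  · have hb : α.act t⁻¹ (F t b a) = 0 := by
      simpa [ha, eq_comm] using h.embed_snd a b t
    exact α.act_injOn t⁻¹ (h.inv_mem _ _ _) (zero_mem _) (hb.trans (α.act_zero _).symm)

lemma translate_embed_mul (s : G) (a b : A) :
    translate k A s (h.embed a) * h.embed b = h.embed (F s a b) := by
  refine ambient_ext (fun r x => ?_) fun r x => ?_
  · change F (s⁻¹ * r)⁻¹ a (F r⁻¹ b x) = F r⁻¹ (F s a b) x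
    rw [h.cond3a, mul_inv_rev, inv_inv]
  · change α.act r⁻¹ (F r (α.act (s⁻¹ * r)⁻¹ (F (s⁻¹ * r) x a)) b) = α.act r⁻¹ (F r x (F s a b))
    rw [h.cond3b, mul_inv_rev, inv_inv, mul_inv_cancel_left]

lemma embed_mul_translate (s : G) (a b : A) :
    h.embed b * translate k A s (h.embed a) = h.embed (α.act s (F s⁻¹ b a)) := by
  refine ambient_ext (fun r x => ?_) fun r x => ?_
  · change F r⁻¹ b (F (s⁻¹ * r)⁻¹ a x) = F r⁻¹ (α.act s (F s⁻¹ b a)) x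
    have h3 := h.cond3b s⁻¹ r⁻¹ b a x
    rw [inv_inv] at h3
    rw [h3, mul_inv_rev, inv_inv]
  · change α.act (s⁻¹ * r)⁻¹ (F (s⁻¹ * r) (α.act r⁻¹ (F r x b)) a) =
      α.act r⁻¹ (F r x (α.act s (F s⁻¹ b a)))
    have h5 := h.cond5b r⁻¹ s x (F s⁻¹ b a) (h.mem _ _ _)
    rw [inv_inv] at h5
    rw [← h5, h.cond3b, mul_inv_rev, inv_inv, mul_inv_cancel_right]

lemma embed_mul (a b : A) : h.embed (a * b) = h.embed a * h.embed b := by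
  rw [← h.F_one, ← h.translate_embed_mul, translate_one]

lemma translate_embed (t : G) {a : A} (ha : a ∈ α.ideal t⁻¹) :
    translate k A t (h.embed a) = h.embed (α.act t a) := by
  refine ambient_ext (fun r x => ?_) fun r x => ?_
  · change F (t⁻¹ * r)⁻¹ a x = F r⁻¹ (α.act t a) x
    rw [← h.cond5a _ _ _ _ ha, mul_inv_rev, inv_inv]
  · change α.act (t⁻¹ * r)⁻¹ (F (t⁻¹ * r) x a) = α.act r⁻¹ (F r x (α.act t a))
    have h5 := h.cond5b r⁻¹ t x a ha
    rw [inv_inv] at h5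
    rw [← h5, mul_inv_rev, inv_inv]

lemma mem_ideal_of_embed_eq {t : G} {a b : A}
    (hab : h.embed a = translate k A t (h.embed b)) : a ∈ α.ideal t := by
  refine h.cond6 t a ⟨b, fun s c => ⟨?_, ?_⟩⟩
  · have hL : (h.embed a ⟨s⁻¹⟩).1 c = (translate k A t (h.embed b) ⟨s⁻¹⟩).1 c := by rw [hab]
    simpa using hL
  · have hz : α.act s⁻¹ (F s c a) = α.act (t⁻¹ * s)⁻¹ (F (t⁻¹ * s) c b) := by
      change (h.embed a ⟨s⟩).2.unop c = (translate k A t (h.embed b) ⟨s⟩).2.unop c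
      rw [hab]
    have hz₁ := α.act_inv_mem (h.mem s c a)
    have hz₂ := α.act_inv_mem (h.mem (t⁻¹ * s) c b)
    rw [← hz, mul_inv_rev, inv_inv] at hz₂
    have hs : F s c a ∈ α.ideal t := by
      have him := (α.act_image (s⁻¹ * t) s).subset ⟨_, ⟨hz₁, hz₂⟩, rfl⟩
      rw [mul_inv_cancel_left, α.act_act_inv (h.mem s c a)] at him
      exact him.2
    have hx : α.act t⁻¹ (F s c a) = F (t⁻¹ * s) c b := by
      have hcomp := α.act_comp t⁻¹ s _ hz₁
        (by rwa [α.act_act_inv (h.mem s c a), inv_inv])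
      rwa [α.act_act_inv (h.mem s c a), hz, α.act_act_inv (h.mem _ _ _)] at hcomp
    rw [← hx, α.act_act_inv hs]

/-- The span of the translates of the image of `A`, as a subalgebra. -/
def envelope : NonUnitalSubalgebra k (Ambient k G A) where
  __ := Submodule.span k (⋃ t : G, Set.range fun a => translate k A t (h.embed a))
  mul_mem' {x y} hx hy := by
    change x ∈ Submodule.span _ _ at hx
    change y ∈ Submodule.span _ _ at hy
    change x * y ∈ Submodule.span _ _
    induction hx, hy using Submodule.span_induction₂ with
    | mem_mem x y hx hy =>
      obtain ⟨s, a, rfl⟩ := Set.mem_iUnion.mp hx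
      obtain ⟨t, b, rfl⟩ := Set.mem_iUnion.mp hy
      refine Submodule.subset_span (Set.mem_iUnion.mpr ⟨t, F (t⁻¹ * s) a b, ?_⟩)
      simp only [← h.translate_embed_mul, map_mul, ← translate_mul, mul_inv_cancel_left]
    | zero_left => simp
    | zero_right => simp
    | add_left x y z _ _ _ hx hy => rw [add_mul]; exact add_mem hx hy
    | add_right x y z _ _ _ hx hy => rw [mul_add]; exact add_mem hx hy
    | smul_left c x y _ _ hx => rw [smul_mul_assoc]; exact Submodule.smul_mem _ _ hx
    | smul_right c x y _ _ hx => rw [mul_smul_comm]; exact Submodule.smul_mem _ _ hx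

lemma translate_embed_mem (t : G) (a : A) : translate k A t (h.embed a) ∈ h.envelope :=
  Submodule.subset_span (Set.mem_iUnion.mpr ⟨t, a, rfl⟩)

lemma embed_mem (a : A) : h.embed a ∈ h.envelope := by
  simpa only [translate_one] using h.translate_embed_mem 1 a

lemma envelope_induction {p : (m : Ambient k G A) → m ∈ h.envelope → Prop} {m : Ambient k G A}
    (hm : m ∈ h.envelope) (gen : ∀ t a, p _ (h.translate_embed_mem t a)) (zero : p 0 (zero_mem _))
    (add : ∀ x y hx hy, p x hx → p y hy → p (x + y) (add_mem hx hy))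
    (smul : ∀ (c : k) x hx, p x hx → p (c • x) (SMulMemClass.smul_mem c hx)) : p m hm := by
  refine Submodule.span_induction (fun x hx => ?_) zero add smul hm
  obtain ⟨t, a, rfl⟩ := Set.mem_iUnion.mp hx
  exact gen t a

lemma translate_mem (s : G) {m : Ambient k G A} (hm : m ∈ h.envelope) :
    translate k A s m ∈ h.envelope := by
  induction m, hm using h.envelope_induction with
  | gen t a => rw [← translate_mul]; exact h.translate_embed_mem _ _
  | zero => rw [map_zero]; exact zero_mem _
  | add x y _ _ hx hy => rw [map_add]; exact add_mem hx hy
  | smul c x _ hx => rw [map_smul]; exact SMulMemClass.smul_mem c hx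

lemma mul_embed {m : Ambient k G A} (hm : m ∈ h.envelope) (c : A) :
    m * h.embed c = h.embed ((m ⟨1⟩).1 c) := by
  induction m, hm using h.envelope_induction with
  | gen t a => simp [h.translate_embed_mul]
  | zero => simp
  | add x y _ _ hx hy => simp [add_mul, hx, hy]
  | smul d x _ hx => simp [hx]

lemma embed_mul_right {m : Ambient k G A} (hm : m ∈ h.envelope) (c : A) :
    h.embed c * m = h.embed ((m ⟨1⟩).2.unop c) := by
  induction m, hm using h.envelope_induction with
  | gen t a => simp [h.embed_mul_translate]
  | zero => simp
  | add x y _ _ hx hy => simp [mul_add, hx, hy]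
  | smul d x _ hx => simp [hx]

/-- The enveloping pair constructed from an enveloping family. -/
def envPair : EnvPair α h.envelope where
  β t := NonUnitalAlgHom.codRestrict
    ((translate k A t).comp (NonUnitalSubalgebraClass.subtype h.envelope)) h.envelope
    fun m => h.translate_mem t m.2
  β_one m := Subtype.ext (translate_one m.1)
  β_comp s t m := Subtype.ext (translate_mul s t m.1)
  μ :=
    { toFun := fun a => ⟨h.embed a, h.embed_mem a⟩
      map_smul' := fun c a => Subtype.ext (map_smul h.embed c a)
      map_zero' := Subtype.ext (map_zero h.embed)
      map_add' := fun a b => Subtype.ext (map_add h.embed a b)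
      map_mul' := fun a b => Subtype.ext (h.embed_mul a b) }
  μ_inj a b hab := h.embed_injective (congrArg Subtype.val hab)
  μ_mul_mem_left := by
    rintro m _ ⟨a, rfl⟩
    exact ⟨_, Subtype.ext (h.mul_embed m.2 a).symm⟩
  μ_mul_mem_right := by
    rintro m _ ⟨a, rfl⟩
    exact ⟨_, Subtype.ext (h.embed_mul_right m.2 a).symm⟩
  inter t := by
    ext m
    constructor
    · rintro ⟨a, ha, rfl⟩
      refine ⟨⟨a, rfl⟩, _, ⟨α.act t⁻¹ a, rfl⟩, Subtype.ext ?_⟩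
      exact (h.translate_embed t (α.act_inv_mem ha)).trans (congrArg h.embed (α.act_act_inv ha))
    · rintro ⟨⟨a, rfl⟩, _, ⟨b, rfl⟩, hb⟩
      exact ⟨a, h.mem_ideal_of_embed_eq (congrArg Subtype.val hb).symm, rfl⟩
  equivar t a ha := Subtype.ext (h.translate_embed t ha)
  spans := by
    rw [eq_top_iff]
    rintro ⟨m, hm⟩ -
    change m ∈ Submodule.span _ _ at hm
    induction hm using Submodule.span_induction with
    | mem x hx =>
      obtain ⟨t, a, rfl⟩ := Set.mem_iUnion.mp hx
      exact Submodule.subset_span (Set.mem_iUnion.mpr ⟨t, _, ⟨a, rfl⟩, rfl⟩)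
    | zero => exact zero_mem _
    | add x y hx hy ihx ihy => exact add_mem ihx ihy
    | smul c x hx ihx => exact Submodule.smul_mem _ c ihx

lemma envPair_family (t : G) (a b : A) :
    h.envPair.μ (F t a b) = h.envPair.β t (h.envPair.μ a) * h.envPair.μ b :=
  Subtype.ext (h.translate_embed_mul t a b).symm

lemma annih_envelope : annih h.envelope = {0} := by
  refine Set.eq_singleton_iff_unique_mem.mpr ⟨fun c => by simp, fun m hm => ?_⟩
  have key (s : G) (c : A) : translate k A s m.1 * h.embed c = 0 ∧
      h.embed c * translate k A s m.1 = 0 := by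
    have hc := hm ⟨_, h.translate_embed_mem s⁻¹ c⟩
    have hs : translate k A s (translate k A s⁻¹ (h.embed c)) = h.embed c := by
      rw [← translate_mul, mul_inv_cancel, translate_one]
    rw [← hs, ← map_mul, ← map_mul]
    exact ⟨(congrArg (translate k A s) (congrArg Subtype.val hc.1)).trans (map_zero _),
      (congrArg (translate k A s) (congrArg Subtype.val hc.2)).trans (map_zero _)⟩
  refine Subtype.ext (ambient_ext (fun r x => ?_) fun r x => ?_)
  · have hx := (key r⁻¹ x).1
    rw [h.mul_embed (h.translate_mem _ m.2), ← map_zero h.embed] at hx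
    simpa using h.embed_injective hx
  · have hx := (key r⁻¹ x).2
    rw [h.embed_mul_right (h.translate_mem _ m.2), ← map_zero h.embed] at hx
    simpa using h.embed_injective hx

end IsEnvFamily

/-- **second half of Theorem 1.9.** Every enveloping family of functions for `α`
arises as the associated family of some enveloping pair of `α` with trivial annihilator;
moreover two enveloping pairs with trivial annihilator are isomorphic iff their associated
families coincide. -/
theorem envFamily_arises_from_envPair_and_classifies
    {k : Type u} [CommRing k] {G : Type v} [Group G] {A : Type w}
    [NonUnitalRing A] [Module k A] [SMulCommClass k A A] [IsScalarTower k A A]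
    (α : AlgPartialAction k G A) :
    (∀ F : G → A → A → A, IsEnvFamily α F →
      ∃ E : EnvelopingOf α,
        letI := E.ringI; letI := E.modI; letI := E.sccI; letI := E.istI
        annih E.carrier = {0} ∧
          ∀ (t : G) (a b : A), E.pair.μ (F t a b) = E.pair.β t (E.pair.μ a) * E.pair.μ b) ∧
    (∀ (B : Type x) (C : Type y),
      ∀ [NonUnitalRing B] [Module k B] [SMulCommClass k B B] [IsScalarTower k B B]
        [NonUnitalRing C] [Module k C] [SMulCommClass k C C] [IsScalarTower k C C]
        (P : EnvPair α B) (Q : EnvPair α C),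
        annih B = {0} → annih C = {0} →
        ∀ (FP FQ : G → A → A → A),
          (∀ (t : G) (a b : A), P.μ (FP t a b) = P.β t (P.μ a) * P.μ b) →
          (∀ (t : G) (a b : A), Q.μ (FQ t a b) = Q.β t (Q.μ a) * Q.μ b) →
          ((∃ φ : B → C, IsEnvPairIso P Q φ) ↔ FP = FQ)) := by
  refine ⟨fun F h => ⟨⟨h.envelope, h.envPair⟩, h.annih_envelope, h.envPair_family⟩, ?_⟩
  intro B C _ _ _ _ _ _ _ _ P Q hB hC FP FQ hP hQ
  constructor
  · rintro ⟨φ, hφ⟩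
    exact hφ.family_eq hP hQ
  · rintro rfl
    exact EnvPair.exists_iso_of_family_eq hB hC hP hQ
end

section
/- Let α be a C*-partial action of a discrete group G on a C*-algebra A which admits an enveloping pair (μ, β) in the algebraic sense. Then for every a, b ∈ A, every t ∈ G and every approximate unit (u_i) of the C*-algebra A_{t⁻¹}, the net (α_t(u_i a) b) converges in A, with limit μ⁻¹(β_t(μ(a))·μ(b)). -/
set_option linter.unusedSectionVars false
set_option linter.unusedVariables false

universe u v w x y

section CStarPrelim

variable (G : Type u) [Group G] (A : Type v) [NonUnitalCStarAlgebra A]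

/-- A C*-partial action of a (discrete) group `G` on a C*-algebra `A`: an algebraic partial
action whose ideals are closed and whose partial maps are *-preserving (i.e. *-isomorphisms
`A_{t⁻¹} → A_t`). -/
structure CStarPartialAction extends AlgPartialAction ℂ G A : Type (max u v) where
  ideal_closed : ∀ t : G, IsClosed (toAlgPartialAction.ideal t : Set A)
  act_star : ∀ t : G, ∀ a ∈ toAlgPartialAction.ideal t⁻¹,
    toAlgPartialAction.act t (star a) = star (toAlgPartialAction.act t a)

variable {G A}

/-- An (increasing) approximate unit of the closed ideal `I`: an increasing net of positive
elements of norm at most `1` with `lim_i ‖u_i x - x‖ = 0` for all `x ∈ I`. -/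
structure IsApproxUnit [PartialOrder A] [StarOrderedRing A] {ι : Type x} [Preorder ι]
    (I : Submodule ℂ A) (u : ι → A) : Prop where
  mem : ∀ i, u i ∈ I
  nonneg : ∀ i, 0 ≤ u i
  norm_le_one : ∀ i, ‖u i‖ ≤ 1
  mono : Monotone u
  approx : ∀ x ∈ I, Filter.Tendsto (fun i => ‖u i * x - x‖) Filter.atTop (nhds 0)

/-- Property (NS): for all `a, b ∈ A`, `t ∈ G` and every approximate unit `(u_i)` of
`A_{t⁻¹}`, the net `(α_t(u_i a) b)` converges in `A`. -/
def HasNS [PartialOrder A] [StarOrderedRing A] (α : CStarPartialAction G A) : Prop :=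
  ∀ (t : G) (a b : A) (ι : Type v) [Preorder ι] [IsDirected ι (· ≤ ·)] [Nonempty ι],
    ∀ u : ι → A, IsApproxUnit (α.ideal t⁻¹) u →
      ∃ x : A, Filter.Tendsto (fun i => α.act t (u i * a) * b) Filter.atTop (nhds x)

/-- A C*-enveloping pair `(μ, β)` for a C*-partial action `α` of a discrete group. -/
structure CStarEnvPair (α : CStarPartialAction G A) (B : Type w) [NonUnitalCStarAlgebra B] :
    Type (max u v w) where
  β : G → B →ₙₐ[ℂ] B
  β_star : ∀ (t : G) (b : B), β t (star b) = star (β t b)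
  β_one : ∀ b : B, β 1 b = b
  β_comp : ∀ (s t : G) (b : B), β (s * t) b = β s (β t b)
  μ : A →ₙₐ[ℂ] B
  μ_star : ∀ a : A, μ (star a) = star (μ a)
  μ_inj : Function.Injective μ
  range_closed : IsClosed (Set.range μ)
  μ_mul_mem_left : ∀ b : B, ∀ x ∈ Set.range μ, b * x ∈ Set.range μ
  μ_mul_mem_right : ∀ b : B, ∀ x ∈ Set.range μ, x * b ∈ Set.range μ
  inter : ∀ t : G, ⇑μ '' (α.ideal t : Set A) = Set.range μ ∩ (⇑(β t) '' Set.range μ)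
  equivar : ∀ t : G, ∀ a ∈ α.ideal t⁻¹, β t (μ a) = μ (α.act t a)
  dense_span : Dense
    ((Submodule.span ℂ (⋃ t : G, ⇑(β t) '' Set.range μ) : Submodule ℂ B) : Set B)

end CStarPrelim

/-- A closed two-sided ideal with an approximate unit is closed under the involution. -/
theorem CStarPartialAction.star_mem_ideal_of_isApproxUnit
    {G : Type u} [Group G] {A : Type v} [NonUnitalCStarAlgebra A]
    [PartialOrder A] [StarOrderedRing A] (α : CStarPartialAction G A) (t : G)
    {ι : Type x} [Preorder ι] [IsDirected ι (· ≤ ·)] [Nonempty ι]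
    {u : ι → A} (hu : IsApproxUnit (α.ideal t) u) {a : A} (ha : a ∈ α.ideal t) :
    star a ∈ α.ideal t := by
  have h : Filter.Tendsto (fun i => star (u i * a)) Filter.atTop (nhds (star a)) :=
    (tendsto_iff_norm_sub_tendsto_zero.2 (hu.approx a ha)).star
  refine (α.ideal_closed t).mem_of_tendsto h (Filter.Eventually.of_forall fun i => ?_)
  rw [star_mul, (IsSelfAdjoint.of_nonneg (hu.nonneg i)).star_eq]
  exact α.mul_mem_left t _ _ (hu.mem i)

/-- If the domain ideal of a partial automorphism is closed under the involution, then the partial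
automorphism is contractive on it. -/
theorem CStarPartialAction.norm_act_le
    {G : Type u} [Group G] {A : Type v} [NonUnitalCStarAlgebra A]
    (α : CStarPartialAction G A) (t : G)
    (hstar : ∀ a ∈ α.ideal t⁻¹, star a ∈ α.ideal t⁻¹) {a : A} (ha : a ∈ α.ideal t⁻¹) :
    ‖α.act t a‖ ≤ ‖a‖ := by
  let S : NonUnitalStarSubalgebra ℂ A :=
    { α.ideal t⁻¹ with
      mul_mem' := fun {x y} _ hy => α.mul_mem_left t⁻¹ x y hy
      star_mem' := fun {x} hx => hstar x hx }
  have : IsClosed (S : Set A) := α.ideal_closed t⁻¹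
  let φ : S →⋆ₙₐ[ℂ] A :=
    { toFun := fun x => α.act t x
      map_smul' := fun c x => α.act_smul t c x x.2
      map_zero' := by simpa using α.act_smul t 0 0 (α.ideal t⁻¹).zero_mem
      map_add' := fun x y => α.act_add t x x.2 y y.2
      map_mul' := fun x y => α.act_mul t x x.2 y y.2
      map_star' := fun x => α.act_star t x x.2 }
  exact NonUnitalStarAlgHom.norm_apply_le φ ⟨a, ha⟩

/-- The product `β_t(μ(a)) μ(b)` lies in `μ(A_t)`. -/
theorem EnvPair.exists_mem_ideal_map_eq_mul
    {k : Type u} [CommRing k] {G : Type v} [Group G] {A : Type w}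
    [NonUnitalRing A] [Module k A] [SMulCommClass k A A] [IsScalarTower k A A]
    {α : AlgPartialAction k G A} {B : Type x} [NonUnitalRing B]
    [Module k B] [SMulCommClass k B B] [IsScalarTower k B B]
    (P : EnvPair α B) (t : G) (a b : A) :
    ∃ x ∈ α.ideal t, P.μ x = P.β t (P.μ a) * P.μ b := by
  have h : P.β t (P.μ a) * P.μ b ∈ P.μ '' (α.ideal t : Set A) := by
    rw [P.inter t]
    refine ⟨P.μ_mul_mem_left _ _ ⟨b, rfl⟩, P.μ a * P.β t⁻¹ (P.μ b),
      P.μ_mul_mem_right _ _ ⟨a, rfl⟩, ?_⟩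
    rw [map_mul, ← P.β_comp, mul_inv_cancel, P.β_one]
  exact h

/-- The partial automorphism `act t` maps its domain onto `ideal t`. -/
theorem AlgPartialAction.exists_act_eq
    {k : Type u} [CommRing k] {G : Type v} [Group G] {A : Type w}
    [NonUnitalRing A] [Module k A] [SMulCommClass k A A] [IsScalarTower k A A]
    (α : AlgPartialAction k G A) {t : G} {x : A} (hx : x ∈ α.ideal t) :
    ∃ y ∈ α.ideal t⁻¹, α.act t y = x := by
  have h : x ∈ α.act t '' ((α.ideal t⁻¹ : Set A) ∩ (α.ideal 1 : Set A)) := by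
    rw [α.act_image, mul_one]
    exact ⟨hx, hx⟩
  obtain ⟨y, hy, hyx⟩ := h
  exact ⟨y, hy.1, hyx⟩

/-- **Remark 2.1.** If a C*-partial action `α` of a discrete group `G` on a
C*-algebra `A` admits an enveloping pair `(μ, β)` in the algebraic sense, then for all
`a, b ∈ A`, `t ∈ G` and every approximate unit `(u_i)` of `A_{t⁻¹}`, the net
`(α_t(u_i a) b)` converges, with limit `μ⁻¹(β_t(μ(a))·μ(b))`. -/
theorem net_converges_of_envPair
    {G : Type u} [Group G] {A : Type v} [NonUnitalCStarAlgebra A]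
    [PartialOrder A] [StarOrderedRing A]
    (α : CStarPartialAction G A)
    {B : Type w} [NonUnitalRing B] [Module ℂ B] [SMulCommClass ℂ B B] [IsScalarTower ℂ B B]
    (P : EnvPair α.toAlgPartialAction B)
    (t : G) (a b : A)
    {ι : Type x} [Preorder ι] [IsDirected ι (· ≤ ·)] [Nonempty ι]
    (u : ι → A) (hu : IsApproxUnit (α.ideal t⁻¹) u) :
    ∃ x : A, P.μ x = P.β t (P.μ a) * P.μ b ∧
      Filter.Tendsto (fun i => α.act t (u i * a) * b) Filter.atTop (nhds x) := by
  obtain ⟨x, hx, hμx⟩ := P.exists_mem_ideal_map_eq_mul t a b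
  obtain ⟨y, hy, rfl⟩ := α.exists_act_eq hx
  refine ⟨α.act t y, hμx, ?_⟩
  have hmem (i : ι) (c : A) : u i * c ∈ α.ideal t⁻¹ := α.mul_mem_right _ _ _ (hu.mem i)
  have key (i : ι) : α.act t (u i * a) * b = α.act t (u i * y) := by
    apply P.μ_inj
    rw [map_mul, ← P.equivar t _ (hmem i a), ← P.equivar t _ (hmem i y), map_mul, map_mul,
      map_mul, map_mul, mul_assoc, ← hμx, P.equivar t y hy]
  have hsub (i : ι) : α.act t (u i * y - y) = α.act t (u i * y) - α.act t y := by
    rw [eq_sub_iff_add_eq, ← α.act_add t _ (sub_mem (hmem i y) hy) _ hy, sub_add_cancel]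
  rw [tendsto_iff_norm_sub_tendsto_zero]
  refine squeeze_zero (fun _ => norm_nonneg _) (fun i => ?_) (hu.approx y hy)
  rw [key, ← hsub]
  exact α.norm_act_le t (fun _ => α.star_mem_ideal_of_isApproxUnit t⁻¹ hu)
    (sub_mem (hmem i y) hy)
end

section
/- Let α be a C*-partial action of a discrete group G on a C*-algebra A. Then α has property (NS) if and only if α has property (NS'): there exist subsets D₁, D₂ ⊆ A, each spanning a dense subspace of A, such that for every a ∈ D₁, b ∈ D₂ and t ∈ G there is some approximate unit (u_i) of A_{t⁻¹} for which the net (α_t(u_i a) b) converges. -/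
set_option linter.unusedSectionVars false
set_option linter.unusedVariables false

universe u v w x y

open Filter Topology

section ApproxUnit

variable {A : Type v} [NonUnitalCStarAlgebra A] [PartialOrder A] [StarOrderedRing A]

/-- The range of a *-homomorphism of C*-algebras admits an approximate unit. -/
theorem exists_isApproxUnit_range {B : Type v} [NonUnitalCStarAlgebra B] (φ : B →⋆ₙₐ[ℂ] A)
    (I : Submodule ℂ A) (hI : (I : Set A) = Set.range φ) :
    ∃ (ι : Type v) (_ : Preorder ι), IsDirected ι (· ≤ ·) ∧ Nonempty ι ∧
      ∃ u : ι → A, IsApproxUnit I u := by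
  let _ : PartialOrder B := CStarAlgebra.spectralOrder B
  have : StarOrderedRing B := CStarAlgebra.spectralOrderedRing B
  have hmono : Monotone φ := OrderHomClass.mono φ
  let S : Set B := {x : B | 0 ≤ x} ∩ Metric.ball 0 1
  have hS : Nonempty S := ⟨⟨0, by simp [S]⟩⟩
  have hdir : IsDirected S (· ≤ ·) :=
    ⟨fun x y => by
      obtain ⟨z, hz, hxz, hyz⟩ := CStarAlgebra.directedOn_nonneg_ball x.1 x.2 y.1 y.2
      exact ⟨⟨z, hz⟩, hxz, hyz⟩⟩
  have hlim : Tendsto (fun x : S => (x : B)) atTop (CStarAlgebra.approximateUnit B) := by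
    rw [(CStarAlgebra.hasBasis_approximateUnit B).tendsto_right_iff]
    intro a ha
    filter_upwards [Ici_mem_atTop (⟨a, ha.1, by simpa using ha.2⟩ : S)] with x hx
    exact ⟨hx, Metric.ball_subset_closedBall x.2.2⟩
  refine ⟨S, inferInstance, hdir, hS, fun x => φ x, ?_⟩
  refine
    { mem := fun x => hI.symm.subset ⟨x, rfl⟩
      nonneg := fun x => by simpa using hmono x.2.1
      norm_le_one := fun x =>
        (NonUnitalStarAlgHom.norm_apply_le φ _).trans (by simpa using x.2.2.out.le)
      mono := fun x y hxy => hmono hxy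
      approx := ?_ }
  intro y hy
  obtain ⟨b, rfl⟩ := hI.subset hy
  have hb : Tendsto (fun x : S => ‖(x : B) * b - b‖) atTop (𝓝 0) :=
    tendsto_iff_norm_sub_tendsto_zero.mp
      (((CStarAlgebra.increasingApproximateUnit B).tendsto_mul_right b).comp hlim)
  refine squeeze_zero (fun _ => norm_nonneg _) (fun x => ?_) hb
  rw [← map_mul, ← map_sub]
  exact NonUnitalStarAlgHom.norm_apply_le φ _

/-- A submodule closed under multiplication and the involution, as a *-subalgebra. -/
def Submodule.toNonUnitalStarSubalgebra (I : Submodule ℂ A)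
    (hmul : ∀ x ∈ I, ∀ y ∈ I, x * y ∈ I) (hstar : ∀ x ∈ I, star x ∈ I) :
    NonUnitalStarSubalgebra ℂ A where
  carrier := I
  add_mem' := I.add_mem
  zero_mem' := I.zero_mem
  smul_mem' := fun c _ hx => I.smul_mem c hx
  mul_mem' := fun hx hy => hmul _ hx _ hy
  star_mem' := fun hx => hstar _ hx

/-- A closed *-subalgebra of a C*-algebra has an approximate unit. -/
theorem exists_isApproxUnit (I : Submodule ℂ A) (hI : IsClosed (I : Set A))
    (hmul : ∀ x ∈ I, ∀ y ∈ I, x * y ∈ I) (hstar : ∀ x ∈ I, star x ∈ I) :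
    ∃ (ι : Type v) (_ : Preorder ι), IsDirected ι (· ≤ ·) ∧ Nonempty ι ∧
      ∃ u : ι → A, IsApproxUnit I u := by
  let S := I.toNonUnitalStarSubalgebra hmul hstar
  have : IsClosed (S : Set A) := hI
  exact exists_isApproxUnit_range (NonUnitalStarSubalgebraClass.subtype S) I
    Subtype.range_coe.symm

/-- Closed two-sided ideals of a C*-algebra are self-adjoint. -/
theorem star_mem_of_isClosed_ideal (I : Submodule ℂ A) (hI : IsClosed (I : Set A))
    (hleft : ∀ (a : A), ∀ x ∈ I, a * x ∈ I) (hright : ∀ (a : A), ∀ x ∈ I, x * a ∈ I)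
    {x : A} (hx : x ∈ I) : star x ∈ I := by
  let J : Submodule ℂ A :=
    { carrier := {y | y ∈ I ∧ star y ∈ I}
      add_mem' := fun h k => ⟨I.add_mem h.1 k.1, by rw [star_add]; exact I.add_mem h.2 k.2⟩
      zero_mem' := by simp
      smul_mem' := fun c _ h =>
        ⟨I.smul_mem c h.1, by rw [star_smul]; exact I.smul_mem _ h.2⟩ }
  have hJ : IsClosed (J : Set A) := hI.inter (hI.preimage continuous_star)
  obtain ⟨ι, _, _, _, u, hu⟩ := exists_isApproxUnit J hJ
    (fun y hy z hz => ⟨hleft _ _ hz.1, by rw [star_mul]; exact hleft _ _ hy.2⟩)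
    (fun y hy => ⟨hy.2, by rw [star_star]; exact hy.1⟩)
  have hxx : x * star x ∈ J := ⟨hright _ _ hx, by simpa using hright _ _ hx⟩
  have hsq : Tendsto (fun i => ‖star x * u i - star x‖ ^ 2) atTop (𝓝 0) := by
    have h2 := (hu.approx _ hxx).mul_const 2
    rw [zero_mul] at h2
    refine squeeze_zero (fun _ => by positivity) (fun i => ?_) h2
    have hstar : star (u i) = u i := (IsSelfAdjoint.of_nonneg (hu.nonneg i)).star_eq
    have hfactor : star (star x * u i - star x) * (star x * u i - star x) =
        (u i * (x * star x) - x * star x) * u i - (u i * (x * star x) - x * star x) := by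
      simp only [star_sub, star_mul, star_star, hstar]
      noncomm_ring
    rw [sq, ← CStarRing.norm_star_mul_self, hfactor]
    refine (norm_sub_le _ _).trans ?_
    have := (norm_mul_le (u i * (x * star x) - x * star x) (u i)).trans
      (mul_le_of_le_one_right (norm_nonneg _) (hu.norm_le_one i))
    linarith
  have hlim : Tendsto (fun i => star x * u i) atTop (𝓝 (star x)) := by
    rw [tendsto_iff_norm_sub_tendsto_zero]
    simpa [Real.sqrt_sq] using hsq.sqrt
  exact hI.mem_of_tendsto hlim (Eventually.of_forall fun i => hleft _ _ (hu.mem i).1)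

/-- An approximate unit of a self-adjoint ideal is also a right approximate unit. -/
theorem IsApproxUnit.tendsto_mul_left {ι : Type*} [Preorder ι] {I : Submodule ℂ A} {u : ι → A}
    (hu : IsApproxUnit I u) {x : A} (hx : star x ∈ I) :
    Tendsto (fun i => x * u i) atTop (𝓝 x) := by
  have h := (tendsto_iff_norm_sub_tendsto_zero.mpr (hu.approx _ hx)).star
  simpa [(IsSelfAdjoint.of_nonneg (hu.nonneg _)).star_eq] using h

end ApproxUnit

/-- A uniformly bounded family of linear maps that converges pointwise on a set with dense span
converges pointwise everywhere. -/
theorem exists_tendsto_of_dense_span {ι E F : Type*} [NormedAddCommGroup E] [NormedSpace ℂ E]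
    [NormedAddCommGroup F] [NormedSpace ℂ F] [CompleteSpace F] {l : Filter ι} [l.NeBot]
    (f : ι → E →ₗ[ℂ] F) (C : ℝ) (hf : ∀ i x, ‖f i x‖ ≤ C * ‖x‖) {D : Set E}
    (hD : Dense ((Submodule.span ℂ D : Submodule ℂ E) : Set E))
    (h : ∀ x ∈ D, ∃ y, Tendsto (fun i => f i x) l (𝓝 y)) (x : E) :
    ∃ y, Tendsto (fun i => f i x) l (𝓝 y) := by
  have hspan : ∀ z ∈ Submodule.span ℂ D, ∃ y, Tendsto (fun i => f i z) l (𝓝 y) := by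
    intro z hz
    induction hz using Submodule.span_induction with
    | mem z hz => exact h z hz
    | zero => exact ⟨0, by simp⟩
    | add z w _ _ hz hw =>
      obtain ⟨y, hy⟩ := hz
      obtain ⟨y', hy'⟩ := hw
      exact ⟨y + y', by simpa using hy.add hy'⟩
    | smul c z _ hz =>
      obtain ⟨y, hy⟩ := hz
      exact ⟨c • y, by simpa using hy.const_smul c⟩
  rw [← cauchy_map_iff_exists_tendsto, Metric.cauchy_iff]
  refine ⟨inferInstance, fun ε hε => ?_⟩
  have hδ : 0 < ε / (4 * (|C| + 1)) := by positivity
  obtain ⟨z, hz, hxz⟩ := Metric.mem_closure_iff.mp (hD x) _ hδ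
  have hclose : ∀ i, dist (f i x) (f i z) < ε / 4 := by
    intro i
    rw [dist_eq_norm, ← map_sub]
    rw [dist_eq_norm, lt_div_iff₀ (by positivity)] at hxz
    have := mul_le_mul_of_nonneg_right (le_abs_self C) (norm_nonneg (x - z))
    nlinarith [hf i (x - z), norm_nonneg (x - z)]
  obtain ⟨y, hy⟩ := hspan z hz
  have hev := hy (Metric.ball_mem_nhds y (by positivity : 0 < ε / 4))
  refine ⟨Metric.ball y (ε / 2), ?_, fun p hp q hq => ?_⟩
  · rw [mem_map]
    filter_upwards [mem_map.mp hev] with i hi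
    have hiz : dist (f i z) y < ε / 4 := hi
    exact Metric.mem_ball.mpr (by linarith [dist_triangle (f i x) (f i z) y, hclose i])
  · rw [Metric.mem_ball] at hp hq
    linarith [dist_triangle_right p q y]

namespace CStarPartialAction

variable {G : Type u} [Group G] {A : Type v} [NonUnitalCStarAlgebra A]
  [PartialOrder A] [StarOrderedRing A] (α : CStarPartialAction G A)

theorem star_mem (t : G) {x : A} (hx : x ∈ α.ideal t) : star x ∈ α.ideal t :=
  star_mem_of_isClosed_ideal _ (α.ideal_closed t) (α.mul_mem_left t) (α.mul_mem_right t) hx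

/-- The domain ideal `A_t`, as a *-subalgebra. -/
def idealSubalgebra (t : G) : NonUnitalStarSubalgebra ℂ A :=
  (α.ideal t).toNonUnitalStarSubalgebra (fun x _ y hy => α.mul_mem_left t x y hy)
    (fun _ hx => α.star_mem t hx)

/-- The partial map `α_t`, as a *-homomorphism `A_{t⁻¹} → A`. -/
def actHom (t : G) : α.idealSubalgebra t⁻¹ →⋆ₙₐ[ℂ] A where
  toFun x := α.act t x
  map_smul' c x := α.act_smul t c x x.2
  map_zero' := by simpa using α.act_smul t 0 0 (α.ideal t⁻¹).zero_mem
  map_add' x y := α.act_add t x x.2 y y.2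
  map_mul' x y := α.act_mul t x x.2 y y.2
  map_star' x := α.act_star t x x.2

theorem norm_act_le_s10 (t : G) {x : A} (hx : x ∈ α.ideal t⁻¹) : ‖α.act t x‖ ≤ ‖x‖ := by
  have : IsClosed (α.idealSubalgebra t⁻¹ : Set A) := α.ideal_closed t⁻¹
  exact NonUnitalStarAlgHom.norm_apply_le (α.actHom t) ⟨x, hx⟩

theorem act_sub (t : G) {x y : A} (hx : x ∈ α.ideal t⁻¹) (hy : y ∈ α.ideal t⁻¹) :
    α.act t (x - y) = α.act t x - α.act t y :=
  map_sub (α.actHom t) ⟨x, hx⟩ ⟨y, hy⟩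

theorem exists_act_eq (t : G) {y : A} (hy : y ∈ α.ideal t) :
    ∃ x ∈ α.ideal t⁻¹, α.act t x = y := by
  have h : y ∈ (α.ideal t : Set A) ∩ (α.ideal (t * 1) : Set A) := ⟨hy, by simpa using hy⟩
  rw [← α.act_image 1 t] at h
  obtain ⟨x, hx, rfl⟩ := h
  exact ⟨x, hx.1, rfl⟩

theorem tendsto_act {ι : Type*} {l : Filter ι} (t : G) {f : ι → A} {x : A}
    (hf : ∀ i, f i ∈ α.ideal t⁻¹) (hx : x ∈ α.ideal t⁻¹) (h : Tendsto f l (𝓝 x)) :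
    Tendsto (fun i => α.act t (f i)) l (𝓝 (α.act t x)) := by
  rw [tendsto_iff_norm_sub_tendsto_zero] at h ⊢
  refine squeeze_zero (fun _ => norm_nonneg _) (fun i => ?_) h
  rw [← α.act_sub t (hf i) hx]
  exact α.norm_act_le_s10 t (Submodule.sub_mem _ (hf i) hx)

/-- Convergence of `α_t(u_i a) b` does not depend on the approximate unit. -/
theorem tendsto_of_isApproxUnit {ι κ : Type*} [Preorder ι] [IsDirected ι (· ≤ ·)] [Nonempty ι]
    [Preorder κ] (t : G) {u : ι → A} {v : κ → A}
    (hu : IsApproxUnit (α.ideal t⁻¹) u) (hv : IsApproxUnit (α.ideal t⁻¹) v) {a b x : A}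
    (hx : Tendsto (fun i => α.act t (u i * a) * b) atTop (𝓝 x)) :
    Tendsto (fun j => α.act t (v j * a) * b) atTop (𝓝 x) := by
  have hua : ∀ i, u i * a ∈ α.ideal t⁻¹ := fun i => α.mul_mem_right _ _ _ (hu.mem i)
  have hxt : x ∈ α.ideal t := (α.ideal_closed t).mem_of_tendsto hx
    (Eventually.of_forall fun i => α.mul_mem_right _ _ _ (α.act_mem t _ (hua i)))
  have hvx : ∀ d ∈ α.ideal t⁻¹, α.act t d * x = α.act t (d * a) * b := by
    intro d hd
    have hdu : Tendsto (fun i => d * u i * a) atTop (𝓝 (d * a)) :=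
      (hu.tendsto_mul_left (α.star_mem _ hd)).mul_const a
    have hact := (α.tendsto_act t (fun i => by
      rw [mul_assoc]; exact α.mul_mem_left _ _ _ (hua i))
      (α.mul_mem_right _ _ _ hd) hdu).mul_const b
    refine tendsto_nhds_unique (hx.const_mul (α.act t d)) (hact.congr fun i => ?_)
    rw [mul_assoc d, α.act_mul t d hd _ (hua i), mul_assoc]
  obtain ⟨y, hy, rfl⟩ := α.exists_act_eq t hxt
  refine (α.tendsto_act t (fun j => α.mul_mem_left _ _ _ hy) hy
    (tendsto_iff_norm_sub_tendsto_zero.mpr (hv.approx y hy))).congr fun j => ?_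
  rw [α.act_mul t _ (hv.mem j) y hy, hvx _ (hv.mem j)]

/-- The bilinear map `(a, b) ↦ α_t(c a) b`, for `c ∈ A_{t⁻¹}`. -/
def actMul (t : G) (c : α.ideal t⁻¹) : A →ₗ[ℂ] A →ₗ[ℂ] A :=
  LinearMap.mk₂ ℂ (fun a b => α.act t (c * a) * b)
    (fun a a' b => by
      rw [mul_add, α.act_add t _ (α.mul_mem_right _ _ _ c.2) _ (α.mul_mem_right _ _ _ c.2),
        add_mul])
    (fun r a b => by
      rw [mul_smul_comm, α.act_smul t _ _ (α.mul_mem_right _ _ _ c.2), smul_mul_assoc])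
    (fun a b b' => mul_add _ _ _)
    (fun r a b => mul_smul_comm _ _ _)

theorem norm_actMul_le (t : G) (c : α.ideal t⁻¹) (hc : ‖(c : A)‖ ≤ 1) (a b : A) :
    ‖α.actMul t c a b‖ ≤ ‖a‖ * ‖b‖ := by
  refine (norm_mul_le _ _).trans (mul_le_mul_of_nonneg_right ?_ (norm_nonneg b))
  refine (α.norm_act_le_s10 t (α.mul_mem_right _ _ _ c.2)).trans ((norm_mul_le _ _).trans ?_)
  exact mul_le_of_le_one_left (norm_nonneg a) hc

end CStarPartialAction

/-- A C*-partial action `α` has property (NS) if and only if it has property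
(NS'): there exist subsets `D₁, D₂ ⊆ A`, each spanning a dense subspace of `A`, such that for
every `a ∈ D₁`, `b ∈ D₂` and `t ∈ G` there is some approximate unit `(u_i)` of `A_{t⁻¹}` for
which the net `(α_t(u_i a) b)` converges. -/
theorem hasNS_iff_NS'
    {G : Type u} [Group G] {A : Type v} [NonUnitalCStarAlgebra A]
    [PartialOrder A] [StarOrderedRing A]
    (α : CStarPartialAction G A) :
    HasNS α ↔
      ∃ D₁ D₂ : Set A,
        Dense ((Submodule.span ℂ D₁ : Submodule ℂ A) : Set A) ∧
        Dense ((Submodule.span ℂ D₂ : Submodule ℂ A) : Set A) ∧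
        ∀ a ∈ D₁, ∀ b ∈ D₂, ∀ t : G,
          ∃ (ι : Type v) (_ : Preorder ι), IsDirected ι (· ≤ ·) ∧ Nonempty ι ∧
            ∃ u : ι → A, IsApproxUnit (α.ideal t⁻¹) u ∧
              ∃ x : A, Filter.Tendsto (fun i => α.act t (u i * a) * b) Filter.atTop (nhds x) := by
  constructor
  · intro h
    refine ⟨Set.univ, Set.univ, by simp, by simp, fun a _ b _ t => ?_⟩
    obtain ⟨ι, hι, hdir, hne, u, hu⟩ := exists_isApproxUnit (α.ideal t⁻¹) (α.ideal_closed t⁻¹)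
      (fun x _ y hy => α.mul_mem_left _ x y hy) (fun _ hx => α.star_mem _ hx)
    exact ⟨ι, hι, hdir, hne, u, hu, h t a b ι u hu⟩
  · rintro ⟨D₁, D₂, hD₁, hD₂, h⟩ t a b κ _ _ _ v hv
    let c : κ → α.ideal t⁻¹ := fun j => ⟨v j, hv.mem j⟩
    refine exists_tendsto_of_dense_span (l := atTop) (fun j => α.actMul t (c j) a) ‖a‖
      (fun j => α.norm_actMul_le t (c j) (hv.norm_le_one j) a) hD₂ (fun b hb => ?_) b
    refine exists_tendsto_of_dense_span (l := atTop) (fun j => (α.actMul t (c j)).flip b) ‖b‖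
      (fun j a => ?_) hD₁ (fun a ha => ?_) a
    · rw [mul_comm]
      exact α.norm_actMul_le t (c j) (hv.norm_le_one j) a b
    · obtain ⟨ι, _, _, _, u, hu, x, hx⟩ := h a ha b hb t
      exact ⟨x, α.tendsto_of_isApproxUnit t hu hv hx⟩
end
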